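/- (Theorem 2) Let N_E ≥ 1 be a natural number, η > 0, c₀ > 0, 0 < ρ_i < ρ_o, γ̄_B > 0 and 0 < R_E < R_B. Set w = (2^{R_E} − 1)/c₀ and, for each j with 0 ≤ j ≤ N_E − 1, set v = j + 2/η. Then (1/(ρ_o² − ρ_i²)) · ∫_{ρ_i²}^{ρ_o²} (R_B − R_E) · e^{−(2^{R_B}−1)/γ̄_B} · (1 − e^{−w·s^{η/2}} · Σ_{j=0}^{N_E−1} (1/j!) · (w·s^{η/2})^j) ds = (R_B − R_E) · e^{−(2^{R_B}−1)/γ̄_B} · (1 − Σ_{j=0}^{N_E−1} (2 w^j / j!) · (γ(v, w ρ_o^η) − γ(v, w ρ_i^η)) / ((ρ_o² − ρ_i²) · η · w^v)), where γ(v, x) = ∫_0^x t^{v−1} e^{−t} dt is the lower incomplete gamma function. -/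

import Mathlib

open Real MeasureTheory Finset

/-- The integrand `t ^ (v - 1) * exp (-t)` of the lower incomplete gamma function is interval
integrable. -/
theorem intervalIntegrable_rpow_sub_one_mul_exp_neg {v x y : ℝ} (hv : 0 < v) :
    IntervalIntegrable (fun t : ℝ => t ^ (v - 1) * Real.exp (-t)) volume x y :=
  (intervalIntegral.intervalIntegrable_rpow' (by linarith)).mul_continuousOn
    (Real.continuous_exp.comp continuous_neg).continuousOn

/-- The substitution `t = w * s ^ p` in an integral of incomplete gamma type. -/
theorem integral_exp_neg_mul_rpow_mul_pow {a b w p : ℝ} (ha : 0 < a) (hb : 0 < b) (hw : 0 < w)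
    (hp : 0 < p) (j : ℕ) :
    ∫ s in a..b, Real.exp (-(w * s ^ p)) * (w * s ^ p) ^ j =
      (∫ t in (w * a ^ p)..(w * b ^ p), t ^ ((j : ℝ) + 1 / p - 1) * Real.exp (-t)) /
        (p * w ^ (1 / p)) := by
  have hpos : ∀ s ∈ Set.uIcc a b, 0 < s := fun s hs => (lt_min ha hb).trans_le hs.1
  have hden : p * w ^ (1 / p) ≠ 0 := by positivity
  rw [eq_div_iff hden, ← intervalIntegral.integral_mul_const,
    ← intervalIntegral.integral_comp_mul_deriv' (f := fun s => w * s ^ p)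
      (f' := fun s => w * (p * s ^ (p - 1)))
      (g := fun t => t ^ ((j : ℝ) + 1 / p - 1) * Real.exp (-t))]
  · refine intervalIntegral.integral_congr fun s hs => ?_
    have hs0 := hpos s hs
    have hsp : 0 < s ^ p := Real.rpow_pos_of_pos hs0 p
    have hexp : (w * s ^ p) ^ ((j : ℝ) + 1 / p - 1) =
        (w * s ^ p) ^ j * (w ^ (1 / p) * s) / (w * s ^ p) := by
      rw [Real.rpow_sub_one (by positivity), Real.rpow_add (by positivity), Real.rpow_natCast,
        Real.mul_rpow hw.le hsp.le, ← Real.rpow_mul hs0.le, mul_one_div_cancel hp.ne',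
        Real.rpow_one]
    simp only [Function.comp_apply, hexp, Real.rpow_sub_one hs0.ne']
    field_simp
  · intro s hs
    exact (Real.hasDerivAt_rpow_const (Or.inl (hpos s hs).ne')).const_mul w
  · exact continuousOn_const.mul (continuousOn_const.mul
      (continuousOn_id.rpow_const fun s hs => Or.inl (hpos s hs).ne'))
  · refine ContinuousOn.mul (continuousOn_id.rpow_const ?_) (by fun_prop)
    rintro _ ⟨s, hs, rfl⟩
    have := hpos s hs
    exact Or.inl (by simp only [id]; positivity)

/-- Theorem 2: the average effective secrecy throughput of the fixed-rate transmission
scheme under the annulus threat model, expressed via the lower incomplete gamma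
function `γinc v x = ∫_0^x t^{v−1} e^{−t} dt`. -/
theorem avg_est_fixed_rate_annulus
    (NE : ℕ) (hNE : 1 ≤ NE) (η c0 ρi ρo γB RB RE : ℝ)
    (hη : 0 < η) (hc0 : 0 < c0) (hρi : 0 < ρi) (hρ : ρi < ρo)
    (hγB : 0 < γB) (hRE : 0 < RE) (hRERB : RE < RB)
    (w : ℝ) (hw : w = ((2 : ℝ) ^ RE - 1) / c0)
    (γinc : ℝ → ℝ → ℝ)
    (hγinc : ∀ v x, γinc v x = ∫ t in (0:ℝ)..x, t ^ (v - 1) * Real.exp (-t)) :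
    (1 / (ρo ^ 2 - ρi ^ 2)) *
      ∫ s in (ρi ^ 2)..(ρo ^ 2),
        (RB - RE) * Real.exp (-((2 : ℝ) ^ RB - 1) / γB) *
          (1 - Real.exp (-(w * s ^ (η / 2))) *
            ∑ j ∈ range NE, (1 / (Nat.factorial j : ℝ)) * (w * s ^ (η / 2)) ^ j)
    = (RB - RE) * Real.exp (-((2 : ℝ) ^ RB - 1) / γB) *
        (1 - ∑ j ∈ range NE, (2 * w ^ j / (Nat.factorial j : ℝ)) *
          ((γinc ((j : ℝ) + 2 / η) (w * ρo ^ η) - γinc ((j : ℝ) + 2 / η) (w * ρi ^ η)) /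
            ((ρo ^ 2 - ρi ^ 2) * η * w ^ ((j : ℝ) + 2 / η)))) := by
  have hρo : 0 < ρo := hρi.trans hρ
  have hw0 : 0 < w := by
    rw [hw]
    exact div_pos (sub_pos.2 (Real.one_lt_rpow one_lt_two hRE)) hc0
  have hp : 0 < η / 2 := by positivity
  have hD : 0 < ρo ^ 2 - ρi ^ 2 := sub_pos.2 (by gcongr)
  have hsq : ∀ ρ : ℝ, 0 < ρ → (ρ ^ 2) ^ (η / 2) = ρ ^ η := fun ρ h => by
    rw [← Real.rpow_natCast, ← Real.rpow_mul h.le]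
    congr 1
    push_cast
    ring
  have hcont : Continuous fun s : ℝ => s ^ (η / 2) :=
    Real.continuous_rpow_const hp.le
  have hterm : ∀ j : ℕ, ∫ s in (ρi ^ 2)..(ρo ^ 2),
      Real.exp (-(w * s ^ (η / 2))) * (w * s ^ (η / 2)) ^ j =
        (γinc ((j : ℝ) + 2 / η) (w * ρo ^ η) - γinc ((j : ℝ) + 2 / η) (w * ρi ^ η)) /
          (η / 2 * w ^ (2 / η)) := fun j => by
    have hv : 0 < (j : ℝ) + 2 / η := by positivity
    rw [integral_exp_neg_mul_rpow_mul_pow (by positivity) (by positivity) hw0 hp, hsq ρi hρi,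
      hsq ρo hρo, one_div_div, hγinc, hγinc, intervalIntegral.integral_interval_sub_left
        (intervalIntegrable_rpow_sub_one_mul_exp_neg hv)
        (intervalIntegrable_rpow_sub_one_mul_exp_neg hv)]
  have hsum : ∫ s in (ρi ^ 2)..(ρo ^ 2), Real.exp (-(w * s ^ (η / 2))) *
      ∑ j ∈ range NE, (1 / (Nat.factorial j : ℝ)) * (w * s ^ (η / 2)) ^ j =
        ∑ j ∈ range NE, (1 / (Nat.factorial j : ℝ)) *
          ((γinc ((j : ℝ) + 2 / η) (w * ρo ^ η) - γinc ((j : ℝ) + 2 / η) (w * ρi ^ η)) /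
            (η / 2 * w ^ (2 / η))) := by
    simp_rw [← hterm, ← intervalIntegral.integral_const_mul]
    rw [← intervalIntegral.integral_finsetSum
      fun j _ => Continuous.intervalIntegrable (by fun_prop) _ _]
    simp_rw [mul_sum, mul_left_comm]
  rw [intervalIntegral.integral_const_mul, intervalIntegral.integral_sub
      (Continuous.intervalIntegrable (by fun_prop) _ _)
      (Continuous.intervalIntegrable (by fun_prop) _ _),
    hsum, intervalIntegral.integral_const, smul_eq_mul, mul_one, mul_left_comm, mul_sub,
    one_div_mul_cancel hD.ne', mul_sum]
  congr 2
  refine sum_congr rfl fun j _ => ?_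
  rw [Real.rpow_add hw0, Real.rpow_natCast]
  have hwη : 0 < w ^ (2 / η) := Real.rpow_pos_of_pos hw0 _
  field_simp
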